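/- arXiv:math/0304304 — 2 statements merged into one kernel-verified Lean document; each statement's English description precedes it below -/
import Mathlib

section
/- Let φ and ψ be invertible n×n matrices over A and let τ ∈ Der. Then H(ψ;τ) + [H(φ;τ) + TrΩ((φ⁻¹·ψ⁻¹·τ(ψ)) ∂φ)] − H(ψ·φ;τ) = (1/2)·TrΩ((φ⁻¹·ψ⁻¹·τ(ψ)) ∂φ) − (1/2)·TrΩ((τ(φ)·φ⁻¹·ψ⁻¹) ∂ψ). (This is the first identity of Theorem 3.4: for abelian bases b, b' = φb, b'' = ψb' of the derivations, the Čech-type defect β_{b'',b',b} = h_{b'',b'} + h_{b',b} − h_{b'',b} of the transition operators h given by formula (3.4)_h equals (1/2)tr{φ⁻¹ψ⁻¹ dψ dφ}.) -/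
noncomputable section

variable (k A : Type*) [Field k] [CharZero k] [CommRing A] [Algebra k A]

/-- Entrywise application of a derivation to a matrix. -/
def dmat {n : ℕ} (τ : Derivation k A A) (φ : Matrix (Fin n) (Fin n) A) :
    Matrix (Fin n) (Fin n) A :=
  Matrix.of fun p q => τ (φ p q)

/-- `TrΩ(M ∂N) := Σ_{p,q} M_{p,q} • ∂(N_{q,p}) ∈ Ω`. -/
def trOmega {n : ℕ} (M N : Matrix (Fin n) (Fin n) A) : KaehlerDifferential k A :=
  ∑ p, ∑ q, M p q • KaehlerDifferential.D k A (N q p)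

/-- One half, as an element of `A`. -/
def half : A := algebraMap k A 2⁻¹

/-- `H(χ;τ) := TrΩ(χ⁻¹ ∂(τ(χ))) − (1/2)·TrΩ((χ⁻¹·τ(χ)·χ⁻¹) ∂χ)`. -/
def Hmat {n : ℕ} (χ : Matrix (Fin n) (Fin n) A) (τ : Derivation k A A) :
    KaehlerDifferential k A :=
  trOmega k A χ⁻¹ (dmat k A τ χ) - half k A • trOmega k A (χ⁻¹ * dmat k A τ χ * χ⁻¹) χ

theorem half_add_half : half k A + half k A = 1 := by
  rw [half, ← map_add, ← map_one (algebraMap k A)]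
  congr 1
  norm_num

set_option linter.unusedSectionVars false in
theorem dmat_mul {n : ℕ} (τ : Derivation k A A) (M N : Matrix (Fin n) (Fin n) A) :
    dmat k A τ (M * N) = dmat k A τ M * N + M * dmat k A τ N := by
  ext p q
  simp only [dmat, Matrix.of_apply, Matrix.mul_apply, Matrix.add_apply, map_sum,
    Derivation.leibniz, smul_eq_mul, ← Finset.sum_add_distrib]
  exact Finset.sum_congr rfl fun _ _ => by ring

set_option linter.unusedSectionVars false in
theorem trOmega_add_left {n : ℕ} (M M' N : Matrix (Fin n) (Fin n) A) :
    trOmega k A (M + M') N = trOmega k A M N + trOmega k A M' N := by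
  simp only [trOmega, Matrix.add_apply, add_smul, Finset.sum_add_distrib]

set_option linter.unusedSectionVars false in
theorem trOmega_add_right {n : ℕ} (M N N' : Matrix (Fin n) (Fin n) A) :
    trOmega k A M (N + N') = trOmega k A M N + trOmega k A M N' := by
  simp only [trOmega, Matrix.add_apply, map_add, smul_add, Finset.sum_add_distrib]

set_option linter.unusedSectionVars false in
/-- The Leibniz rule for `TrΩ`, using cyclicity of the trace. -/
theorem trOmega_mul_right {n : ℕ} (M P Q : Matrix (Fin n) (Fin n) A) :
    trOmega k A M (P * Q) = trOmega k A (Q * M) P + trOmega k A (M * P) Q := by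
  simp only [trOmega, Matrix.mul_apply, map_sum, Derivation.leibniz, smul_add, Finset.smul_sum,
    Finset.sum_smul, Finset.sum_add_distrib, smul_smul]
  rw [add_comm]
  congr 1
  · rw [Finset.sum_comm, Finset.sum_comm_cycle]
    refine Finset.sum_congr rfl fun _ _ => Finset.sum_congr rfl fun _ _ =>
      Finset.sum_congr rfl fun _ _ => by rw [mul_comm]
  · exact Finset.sum_congr rfl fun _ _ => Finset.sum_comm

/-- (3.4)_β : `H(ψ;τ) + [H(φ;τ) + TrΩ((φ⁻¹ψ⁻¹τ(ψ)) ∂φ)] − H(ψφ;τ)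
  = ½ TrΩ((φ⁻¹ψ⁻¹τ(ψ)) ∂φ) − ½ TrΩ((τ(φ)φ⁻¹ψ⁻¹) ∂ψ)`. -/
theorem beta_formula {n : ℕ} (hn : 0 < n)
    (φ ψ : Matrix (Fin n) (Fin n) A) (hφ : IsUnit φ) (hψ : IsUnit ψ)
    (τ : Derivation k A A) :
    Hmat k A ψ τ + (Hmat k A φ τ + trOmega k A (φ⁻¹ * ψ⁻¹ * dmat k A τ ψ) φ)
        - Hmat k A (ψ * φ) τ
      = half k A • trOmega k A (φ⁻¹ * ψ⁻¹ * dmat k A τ ψ) φ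
        - half k A • trOmega k A (dmat k A τ φ * φ⁻¹ * ψ⁻¹) ψ := by
  have hφ' : IsUnit φ.det := (Matrix.isUnit_iff_isUnit_det φ).mp hφ
  have hψ' : IsUnit ψ.det := (Matrix.isUnit_iff_isUnit_det ψ).mp hψ
  have h := half_add_half k A
  simp only [Hmat, dmat_mul, Matrix.mul_inv_rev, mul_add, add_mul, trOmega_add_left,
    trOmega_add_right, trOmega_mul_right, ← mul_assoc, Matrix.mul_nonsing_inv _ hφ',
    Matrix.mul_nonsing_inv_cancel_right _ _ hφ', Matrix.nonsing_inv_mul_cancel_right _ _ hψ',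
    one_mul]
  match_scalars <;> grind
end
end

section
/- Let D : Der × Der → Ω be a k-bilinear alternating map such that (i) for all τ, τ', τ'' ∈ Der: ⟨τ'', D(τ,τ')⟩ + ⟨τ', D(τ,τ'')⟩ = 0, and (ii) for all τ, τ', τ'', σ ∈ Der: 3·[ τ(⟨σ, D(τ',τ'')⟩) − ⟨⁅τ,σ⁆, D(τ',τ'')⟩ + τ'(⟨σ, D(τ'',τ)⟩) − ⟨⁅τ',σ⁆, D(τ'',τ)⟩ + τ''(⟨σ, D(τ,τ')⟩) − ⟨⁅τ'',σ⁆, D(τ,τ')⟩ − ⟨σ, D(⁅τ,τ'⁆,τ'')⟩ − ⟨σ, D(⁅τ',τ''⁆,τ)⟩ − ⟨σ, D(⁅τ'',τ⁆,τ')⟩ ] = σ( ⟨τ, D(τ',τ'')⟩ + ⟨τ', D(τ'',τ)⟩ + ⟨τ'', D(τ,τ')⟩ ). Then the function ω(τ,τ',τ'') := ⟨τ'', D(τ,τ')⟩ is totally antisymmetric in its three arguments and is closed: for all τ₀, τ₁, τ₂, τ₃ ∈ Der, τ₀(ω(τ₁,τ₂,τ₃)) − τ₁(ω(τ₀,τ₂,τ₃))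 + τ₂(ω(τ₀,τ₁,τ₃)) − τ₃(ω(τ₀,τ₁,τ₂)) − ω(⁅τ₀,τ₁⁆,τ₂,τ₃) + ω(⁅τ₀,τ₂⁆,τ₁,τ₃) − ω(⁅τ₀,τ₃⁆,τ₁,τ₂) − ω(⁅τ₁,τ₂⁆,τ₀,τ₃) + ω(⁅τ₁,τ₃⁆,τ₀,τ₂) − ω(⁅τ₂,τ₃⁆,τ₀,τ₁) = 0. (Section 3.1: the difference c_{A,A'} of the (0)-operations of two vertex algebroids with the same underlying data — here D = c − c', where both (⟨,⟩,c) and (⟨,⟩,c') satisfy (AlgScind2) and (AlgScind3), so D satisfies the stated homogeneous paired identities — defines a closed 3-form ω_{A,A'}.) -/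
noncomputable section

variable (k A : Type*) [Field k] [CharZero k] [CommRing A] [Algebra k A]

/-- The pairing `⟨τ, ω⟩ ∈ A` of a derivation with a Kähler differential,
so that `⟨τ, a•∂b⟩ = a·τ(b)`. -/
def pairD (τ : Derivation k A A) (ω : KaehlerDifferential k A) : A :=
  τ.liftKaehlerDifferential ω

/-- Section 3.1: the difference `D = c − c'` of the `(0)`-operations of two vertex
algebroids with the same underlying data satisfies the stated homogeneous paired
identities, and the function `ω(τ,τ',τ'') := ⟨τ'', D(τ,τ')⟩` is a closed 3-form. -/
theorem difference_is_closed_three_form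
    (D : Derivation k A A →ₗ[k] Derivation k A A →ₗ[k] KaehlerDifferential k A)
    (halt : ∀ τ, D τ τ = 0)
    (h1 : ∀ τ τ' τ'' : Derivation k A A,
      pairD k A τ'' (D τ τ') + pairD k A τ' (D τ τ'') = 0)
    (h2 : ∀ τ τ' τ'' σ : Derivation k A A,
      (3 : A) *
          (τ (pairD k A σ (D τ' τ'')) - pairD k A ⁅τ, σ⁆ (D τ' τ'')
            + τ' (pairD k A σ (D τ'' τ)) - pairD k A ⁅τ', σ⁆ (D τ'' τ)
            + τ'' (pairD k A σ (D τ τ')) - pairD k A ⁅τ'', σ⁆ (D τ τ')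
            - pairD k A σ (D ⁅τ, τ'⁆ τ'')
            - pairD k A σ (D ⁅τ', τ''⁆ τ)
            - pairD k A σ (D ⁅τ'', τ⁆ τ'))
        = σ (pairD k A τ (D τ' τ'') + pairD k A τ' (D τ'' τ)
            + pairD k A τ'' (D τ τ'))) :
    (∀ τ τ' τ'' : Derivation k A A,
      pairD k A τ'' (D τ τ') = -pairD k A τ'' (D τ' τ) ∧
      pairD k A τ'' (D τ τ') = -pairD k A τ' (D τ τ'')) ∧
    (∀ τ₀ τ₁ τ₂ τ₃ : Derivation k A A,
      τ₀ (pairD k A τ₃ (D τ₁ τ₂)) - τ₁ (pairD k A τ₃ (D τ₀ τ₂))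
        + τ₂ (pairD k A τ₃ (D τ₀ τ₁)) - τ₃ (pairD k A τ₂ (D τ₀ τ₁))
        - pairD k A τ₃ (D ⁅τ₀, τ₁⁆ τ₂) + pairD k A τ₃ (D ⁅τ₀, τ₂⁆ τ₁)
        - pairD k A τ₂ (D ⁅τ₀, τ₃⁆ τ₁) - pairD k A τ₃ (D ⁅τ₁, τ₂⁆ τ₀)
        + pairD k A τ₂ (D ⁅τ₁, τ₃⁆ τ₀) - pairD k A τ₁ (D ⁅τ₂, τ₃⁆ τ₀) = 0) := by
  have map_swap (τ τ' : Derivation k A A) : D τ τ' = -D τ' τ := by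
    have h := halt (τ + τ')
    simp only [map_add, LinearMap.add_apply, halt, zero_add, add_zero] at h
    exact eq_neg_of_add_eq_zero_right h
  have swap₁₂ (τ τ' τ'' : Derivation k A A) :
      pairD k A τ'' (D τ τ') = -pairD k A τ'' (D τ' τ) := by
    rw [map_swap τ τ', pairD, map_neg, pairD]
  have swap₂₃ (τ τ' τ'' : Derivation k A A) :
      pairD k A τ'' (D τ τ') = -pairD k A τ' (D τ τ'') :=
    eq_neg_of_add_eq_zero_left (h1 τ τ' τ'')
  have rotate (τ τ' τ'' : Derivation k A A) :
      pairD k A τ'' (D τ τ') = pairD k A τ' (D τ'' τ) := by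
    rw [swap₂₃, swap₁₂, neg_neg]
  refine ⟨fun τ τ' τ'' => ⟨swap₁₂ τ τ' τ'', swap₂₃ τ τ' τ''⟩, fun τ₀ τ₁ τ₂ τ₃ => ?_⟩
  have three_cancel {x y : A} (h : (3 : A) * x = 3 * y) : x = y := by
    have h3 : IsUnit (3 : A) := by
      simpa only [map_ofNat] using (IsUnit.mk0 (3 : k) (by norm_num)).map (algebraMap k A)
    exact h3.mul_left_cancel h
  have key := h2 τ₀ τ₁ τ₂ τ₃
  rw [← rotate τ₀ τ₁ τ₂, rotate τ₁ τ₂ τ₀, map_add, map_add,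
    show ∀ x : A, x + x + x = 3 * x by intro x; ring] at key
  have closed := three_cancel key
  have lie_swap : pairD k A τ₃ (D ⁅τ₂, τ₀⁆ τ₁) = -pairD k A τ₃ (D ⁅τ₀, τ₂⁆ τ₁) := by
    rw [← lie_skew τ₂ τ₀, map_neg, LinearMap.neg_apply, pairD, map_neg, pairD]
  rw [swap₁₂ τ₂ τ₀ τ₃, map_neg, lie_swap, rotate τ₁ τ₂ ⁅τ₀, τ₃⁆, rotate τ₂ τ₀ ⁅τ₁, τ₃⁆,
    swap₂₃ ⁅τ₁, τ₃⁆ τ₂ τ₀, rotate τ₀ τ₁ ⁅τ₂, τ₃⁆] at closed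
  linear_combination closed
end
end
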